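/- The function K_a is continuous on the space ([X], D) of Banach spaces isomorphic to X, equipped with the Banach–Mazur pseudometric D(Y,Z) = inf{log(‖T‖‖T⁻¹‖) : T: Y → Z isomorphism}; consequently the set {K_a(Y) : Y ≅ X} is an interval of the form (b, 2] or [b, 2] for some b ∈ [1, 2]. -/

import Mathlib

open Set Filter

noncomputable section

/-- `S` is a `(c₁, c₂, d)`-bounded and separated antipodal subset of `X`. -/
def IsBSA (X : Type*) [NormedAddCommGroup X] [NormedSpace ℝ X] (S : Set X)
    (c₁ c₂ d : ℝ) : Prop :=
  (∀ x ∈ S, ‖x‖ ≤ c₁) ∧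
  ∀ x ∈ S, ∀ y ∈ S, x ≠ y → ∃ f : X →L[ℝ] ℝ, ‖f‖ ≤ c₂ ∧ d ≤ f y - f x ∧
    ∀ z ∈ S, f x ≤ f z ∧ f z ≤ f y

/-- The antipodal Kottman constant `K_a(X)`. -/
def Ka (X : Type*) [NormedAddCommGroup X] [NormedSpace ℝ X] : ℝ :=
  sSup {d : ℝ | ∃ S : Set X, S.Infinite ∧ IsBSA X S 1 1 d}

/-- The Kottman (separation) constant `K(X)`. -/
def Kc (X : Type*) [NormedAddCommGroup X] : ℝ :=
  sSup {d : ℝ | ∃ S : Set X, S ⊆ Metric.closedBall 0 1 ∧ S.Infinite ∧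
    ∀ x ∈ S, ∀ y ∈ S, x ≠ y → d ≤ ‖x - y‖}

universe u

open scoped NNReal Topology

section KottmanConstant

variable {Y : Type*} [NormedAddCommGroup Y] [NormedSpace ℝ Y]
  {Z : Type*} [NormedAddCommGroup Z] [NormedSpace ℝ Z]

theorem le_two_of_isBSA {d : ℝ} {S : Set Y} (hS : S.Infinite) (h : IsBSA Y S 1 1 d) :
    d ≤ 2 := by
  obtain ⟨x, hx, y, hy, hxy⟩ := hS.nontrivial
  obtain ⟨f, hf, hd, -⟩ := h.2 x hx y hy hxy
  have key : ∀ z ∈ S, |f z| ≤ 1 := fun z hz => by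
    have h1 := f.le_opNorm z
    have h2 := h.1 z hz
    rw [Real.norm_eq_abs] at h1
    nlinarith [norm_nonneg f, norm_nonneg z]
  have h1 := abs_le.1 (key x hx)
  have h2 := abs_le.1 (key y hy)
  linarith

theorem bddAbove_isBSA : BddAbove {d : ℝ | ∃ S : Set Y, S.Infinite ∧ IsBSA Y S 1 1 d} :=
  ⟨2, fun _ ⟨_, hS, h⟩ => le_two_of_isBSA hS h⟩

theorem Ka_le_two : Ka Y ≤ 2 :=
  Real.sSup_le (fun _ ⟨_, hS, h⟩ => le_two_of_isBSA hS h) zero_le_two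

theorem le_Ka {d : ℝ} {S : Set Y} (hS : S.Infinite) (h : IsBSA Y S 1 1 d) : d ≤ Ka Y :=
  le_csSup bddAbove_isBSA ⟨S, hS, h⟩

/-- A sequence all of whose pairs are separated by antipodal functionals bounds `Ka` below. -/
theorem le_Ka_of_seq {d : ℝ} {y : ℕ → Y} (hinj : Function.Injective y) (hy : ∀ n, ‖y n‖ ≤ 1)
    (h : ∀ i j, i < j → ∃ f : Y →L[ℝ] ℝ, ‖f‖ ≤ 1 ∧ d ≤ f (y j) - f (y i) ∧
      ∀ k, f (y i) ≤ f (y k) ∧ f (y k) ≤ f (y j)) : d ≤ Ka Y := by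
  refine le_Ka (infinite_range_of_injective hinj) ⟨?_, ?_⟩
  · rintro _ ⟨n, rfl⟩
    exact hy n
  · rintro _ ⟨i, rfl⟩ _ ⟨j, rfl⟩ hij
    have hij' : i ≠ j := fun e => hij (by rw [e])
    rcases lt_or_gt_of_ne hij' with hlt | hlt
    · obtain ⟨f, hf, hd, hk⟩ := h i j hlt
      refine ⟨f, hf, hd, ?_⟩
      rintro _ ⟨k, rfl⟩
      exact hk k
    · obtain ⟨f, hf, hd, hk⟩ := h j i hlt
      refine ⟨-f, by rwa [norm_neg], ?_, ?_⟩
      · simp only [neg_apply]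
        linarith
      · rintro _ ⟨k, rfl⟩
        simp only [neg_apply, neg_le_neg_iff]
        exact (hk k).symm

/-- `Ka` distorts by at most the distortion of an isomorphism. -/
theorem Ka_le_mul_Ka (T : Y ≃ₗ[ℝ] Z) {A B : ℝ} (hA : 0 < A) (hB : 0 < B)
    (hTA : ∀ y, ‖T y‖ ≤ A * ‖y‖) (hTB : ∀ z, ‖T.symm z‖ ≤ B * ‖z‖) (hZ : 0 ≤ Ka Z) :
    Ka Y ≤ A * B * Ka Z := by
  refine Real.sSup_le ?_ (by positivity)
  rintro d ⟨S, hS, hb, hsep⟩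
  rw [← div_le_iff₀' (by positivity)]
  have hinj : Function.Injective (fun y : Y => A⁻¹ • T y) :=
    (smul_right_injective Z (inv_ne_zero hA.ne')).comp T.injective
  refine le_Ka (hS.image hinj.injOn) ⟨?_, ?_⟩
  · rintro _ ⟨x, hx, rfl⟩
    rw [norm_smul, norm_inv, Real.norm_of_nonneg hA.le, inv_mul_le_iff₀ hA, mul_one]
    have := hTA x
    nlinarith [hb x hx]
  · rintro _ ⟨x, hx, rfl⟩ _ ⟨y, hy, rfl⟩ hxy
    obtain ⟨f, hf, hd, hk⟩ := hsep x hx y hy (fun e => hxy (by rw [e]))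
    set g : Z →L[ℝ] ℝ := B⁻¹ • f.comp (T.symm.toLinearMap.mkContinuous B hTB) with hg
    have hgv : ∀ v, g (A⁻¹ • T v) = (A * B)⁻¹ * f v := fun v => by
      simp [hg]
      ring
    refine ⟨g, ?_, ?_, ?_⟩
    · rw [hg, norm_smul, norm_inv, Real.norm_of_nonneg hB.le, inv_mul_le_iff₀ hB, mul_one]
      have h1 := f.opNorm_comp_le (T.symm.toLinearMap.mkContinuous B hTB)
      have h2 := LinearMap.mkContinuous_norm_le T.symm.toLinearMap hB.le hTB
      nlinarith [norm_nonneg f, norm_nonneg (T.symm.toLinearMap.mkContinuous B hTB)]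
    · simp only [hgv]
      rw [div_eq_inv_mul, ← mul_sub]
      gcongr
    · rintro _ ⟨z, hz, rfl⟩
      simp only [hgv]
      have := hk z hz
      constructor
      · gcongr
        exact this.1
      · gcongr
        exact this.2

theorem exists_triangular_system (hinf : ¬FiniteDimensional ℝ Y) :
    ∃ (y : ℕ → Y) (g : ℕ → Y →L[ℝ] ℝ), (∀ n, ‖y n‖ = 1) ∧ (∀ n, ‖g n‖ ≤ 1) ∧
      (∀ n, g n (y n) = 1) ∧ ∀ n k, n < k → g n (y k) = 0 := by
  obtain ⟨F, hP, hr⟩ := exists_seq_of_forall_finset_exists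
    (fun p : Y × (Y →L[ℝ] ℝ) => ‖p.1‖ = 1 ∧ ‖p.2‖ ≤ 1 ∧ p.2 p.1 = 1)
    (fun p q => p.2 q.1 = 0) (by
      intro s _
      let L : Y →ₗ[ℝ] (s → ℝ) := LinearMap.pi fun p => (p.1.2 : Y →ₗ[ℝ] ℝ)
      have hL : ¬Function.Injective L := fun h => hinf (FiniteDimensional.of_injective L h)
      rw [← LinearMap.ker_eq_bot, Submodule.eq_bot_iff] at hL
      push Not at hL
      obtain ⟨x, hx, hx0⟩ := hL
      have hx' : ‖x‖ ≠ 0 := norm_ne_zero_iff.2 hx0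
      have hn : ‖‖x‖⁻¹ • x‖ = 1 := by
        rw [norm_smul, norm_inv, norm_norm, inv_mul_cancel₀ hx']
      obtain ⟨g, hg, hgx⟩ := exists_dual_vector'' ℝ (‖x‖⁻¹ • x)
      refine ⟨(‖x‖⁻¹ • x, g), ⟨hn, hg, ?_⟩, ?_⟩
      · simpa [hn] using hgx
      · intro p hp
        have : p.2 x = 0 := congrFun (LinearMap.mem_ker.1 hx) ⟨p, hp⟩
        simp [this])
  exact ⟨fun n => (F n).1, fun n => (F n).2, fun n => (hP n).1, fun n => (hP n).2.1,
    fun n => (hP n).2.2, hr⟩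

/-- Prescribed values on an initial segment of a triangular system are attained by a functional
vanishing on the rest. -/
theorem exists_functional_of_triangular {y : ℕ → Y} {g : ℕ → Y →L[ℝ] ℝ} (hy : ∀ n, ‖y n‖ = 1)
    (hg : ∀ n, ‖g n‖ ≤ 1) (hgy : ∀ n, g n (y n) = 1) (hlt : ∀ n k, n < k → g n (y k) = 0)
    (n : ℕ) : ∀ e : ℕ → ℝ, ∃ h : Y →L[ℝ] ℝ, (∀ m < n, h (y m) = e m) ∧
      (∀ m, n ≤ m → h (y m) = 0) ∧ ‖h‖ ≤ ∑ k ∈ Finset.range n, 2 ^ k * |e k| := by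
  induction n with
  | zero => exact fun e => ⟨0, by simp, by simp, by simp⟩
  | succ n ih =>
    intro e
    obtain ⟨h, h1, h2, h3⟩ := ih fun m => e m - e n * g n (y m)
    refine ⟨e n • g n + h, ?_, ?_, ?_⟩
    · intro m hm
      rcases Nat.lt_succ_iff_lt_or_eq.1 hm with hm | rfl
      · simp [h1 m hm]
      · simp [h2 m le_rfl, hgy]
    · intro m hm
      simp [h2 m (by omega), hlt n m (by omega)]
    · have hab : ∀ m, |g n (y m)| ≤ 1 := fun m => by
        have := (g n).le_opNorm (y m)
        rw [hy, mul_one, Real.norm_eq_abs] at this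
        exact this.trans (hg n)
      have hsum : ∑ k ∈ Finset.range n, (2 : ℝ) ^ k = 2 ^ n - 1 := by
        rw [geom_sum_eq (by norm_num)]
        norm_num
      calc ‖e n • g n + h‖ ≤ ‖e n • g n‖ + ‖h‖ := norm_add_le _ _
        _ ≤ |e n| + ∑ k ∈ Finset.range n, 2 ^ k * (|e k| + |e n|) := by
            gcongr
            · rw [norm_smul, Real.norm_eq_abs]
              exact mul_le_of_le_one_right (abs_nonneg _) (hg n)
            · refine h3.trans (Finset.sum_le_sum fun k _ => ?_)
              gcongr
              refine (abs_sub _ _).trans ?_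
              rw [abs_mul]
              gcongr
              exact mul_le_of_le_one_right (abs_nonneg _) (hab k)
        _ = ∑ k ∈ Finset.range (n + 1), 2 ^ k * |e k| := by
            simp only [mul_add, Finset.sum_add_distrib, ← Finset.sum_mul, hsum,
              Finset.sum_range_succ]
            ring

/-- A bounded double sequence has a subsequence along which its lower triangular part converges
to a constant at a geometric rate. -/
theorem exists_strictMono_lower_triangle (a : ℕ → ℕ → ℝ) (ha : ∀ n k, |a n k| ≤ 1) {ε : ℝ}
    (hε : 0 < ε) : ∃ (l : ℝ) (φ : ℕ → ℕ), StrictMono φ ∧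
      ∀ k n, k < n → |a (φ n) (φ k) - l| ≤ ε * (1 / 4) ^ k := by
  have hlim : ∀ u : ℕ → ℝ, (∀ n, |u n| ≤ 1) →
      ∃ l, |l| ≤ 1 ∧ Tendsto u (hyperfilter ℕ : Filter ℕ) (𝓝 l) := by
    intro u hu
    obtain ⟨l, hl, hl'⟩ := (isCompact_Icc (a := (-1 : ℝ)) (b := 1)).ultrafilter_le_nhds
      ((hyperfilter ℕ).map u) (by
        rw [Ultrafilter.coe_map, le_principal_iff, mem_map]
        exact Eventually.of_forall fun n => abs_le.1 (hu n))
    exact ⟨l, abs_le.2 hl, hl'⟩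
  choose L hL1 hL using fun k => hlim (fun n => a n k) (fun n => ha n k)
  obtain ⟨l, -, hl⟩ := hlim L hL1
  have hnear : ∀ {u : ℕ → ℝ} {c : ℝ}, Tendsto u (hyperfilter ℕ : Filter ℕ) (𝓝 c) → ∀ η > 0,
      ∀ᶠ n in (hyperfilter ℕ : Filter ℕ), |u n - c| < η := fun h η hη => by
    simpa [Real.dist_eq] using Metric.tendsto_nhds.1 h η hη
  obtain ⟨F, hP, hr⟩ := exists_seq_of_forall_finset_exists
    (fun p : ℕ × ℕ => |L p.1 - l| < ε * (1 / 4) ^ p.2)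
    (fun p q => p.1 < q.1 ∧ p.2 < q.2 ∧ |a q.1 p.1 - l| < ε * (1 / 4) ^ p.2) (by
      intro s hs
      obtain ⟨k, hk⟩ : ∃ k, ∀ p ∈ s, p.2 < k :=
        ⟨s.sup Prod.snd + 1, fun p hp => Nat.lt_succ_of_le (Finset.le_sup (f := Prod.snd) hp)⟩
      have hev : ∀ᶠ m in (hyperfilter ℕ : Filter ℕ),
          ∀ p ∈ s, p.1 < m ∧ |a m p.1 - l| < ε * (1 / 4) ^ p.2 := by
        rw [Filter.eventually_all_finset]
        intro p hp
        have hgt : ∀ᶠ m in (hyperfilter ℕ : Filter ℕ), p.1 < m :=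
          Nat.hyperfilter_le_atTop (eventually_gt_atTop p.1)
        filter_upwards [hgt, hnear (hL p.1) (ε * (1 / 4) ^ p.2 - |L p.1 - l|)
          (sub_pos.2 (hs p hp))] with m hm1 hm2
        refine ⟨hm1, ?_⟩
        have := abs_sub_le (a m p.1) (L p.1) l
        linarith
      obtain ⟨m, hm1, hm2⟩ := (hev.and (hnear hl (ε * (1 / 4) ^ k) (by positivity))).exists
      exact ⟨(m, k), hm2, fun p hp => ⟨(hm1 p hp).1, hk p hp, (hm1 p hp).2⟩⟩)
  have hmono : StrictMono fun n => (F n).2 := fun m n h => (hr m n h).2.1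
  refine ⟨l, fun n => (F n).1, fun m n h => (hr m n h).1, fun k n h => ?_⟩
  refine (hr k n h).2.2.le.trans ?_
  gcongr ε * ?_
  exact pow_le_pow_of_le_one (by norm_num) (by norm_num) (hmono.le_apply)

theorem exists_step_system (hinf : ¬FiniteDimensional ℝ Y) {ε : ℝ} (hε : 0 < ε) :
    ∃ (l : ℝ) (y : ℕ → Y) (f : ℕ → Y →L[ℝ] ℝ), l ≤ 1 ∧ (∀ n, ‖y n‖ = 1) ∧
      (∀ n, ‖f n‖ ≤ 1 + ε) ∧ (∀ n, f n (y n) = 1) ∧ (∀ n k, k < n → f n (y k) = l) ∧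
      ∀ n k, n < k → f n (y k) = 0 := by
  obtain ⟨y, g, hy, hg, hgy, hlt⟩ := exists_triangular_system hinf
  have hab : ∀ n m, |g n (y m)| ≤ 1 := fun n m => by
    have := (g n).le_opNorm (y m)
    rw [hy, mul_one, Real.norm_eq_abs] at this
    exact this.trans (hg n)
  obtain ⟨l, φ, hφ, hl⟩ := exists_strictMono_lower_triangle (fun n k => g n (y k)) hab
    (half_pos hε)
  have hl1 : l ≤ 1 := by
    have hlim : Tendsto (fun k : ℕ => 1 + ε / 2 * (1 / 4 : ℝ) ^ k) atTop (𝓝 (1 + ε / 2 * 0)) :=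
      ((tendsto_pow_atTop_nhds_zero_of_lt_one (by norm_num) (by norm_num)).const_mul _).const_add _
    rw [mul_zero, add_zero] at hlim
    refine ge_of_tendsto' hlim fun k => ?_
    have h1 := abs_le.1 (hl k (k + 1) k.lt_succ_self)
    have h2 := abs_le.1 (hab (φ (k + 1)) (φ k))
    linarith [h1.1, h2.2]
  choose h h1 h2 h3 using fun n => exists_functional_of_triangular (y := y ∘ φ) (g := g ∘ φ)
    (fun n => hy _) (fun n => hg _) (fun n => hgy _) (fun n k hnk => hlt _ _ (hφ hnk)) n
    (fun k => g (φ n) (y (φ k)) - l)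
  refine ⟨l, y ∘ φ, fun n => g (φ n) - h n, hl1, fun n => hy _, fun n => ?_, fun n => ?_,
    fun n k hk => ?_, fun n k hk => ?_⟩
  · refine (norm_sub_le _ _).trans (add_le_add (hg _) ((h3 n).trans ?_))
    calc ∑ k ∈ Finset.range n, 2 ^ k * |g (φ n) (y (φ k)) - l|
        ≤ ∑ k ∈ Finset.range n, ε / 2 * (1 / 2) ^ k := by
          refine Finset.sum_le_sum fun k hk => ?_
          calc (2 : ℝ) ^ k * |g (φ n) (y (φ k)) - l| ≤ 2 ^ k * (ε / 2 * (1 / 4) ^ k) := by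
                gcongr
                exact hl k n (Finset.mem_range.1 hk)
            _ = ε / 2 * (1 / 2) ^ k := by
                rw [mul_left_comm, ← mul_pow]
                norm_num
      _ = ε / 2 * ∑ k ∈ Finset.range n, (1 / 2 : ℝ) ^ k := by rw [Finset.mul_sum]
      _ ≤ ε / 2 * 2 := by
          gcongr
          exact sum_geometric_two_le n
      _ = ε := by ring
  · have := h2 n n le_rfl
    simp only [Function.comp_apply] at this
    simp [this, hgy]
  · have := h1 n k hk
    simp only [Function.comp_apply] at this
    simp [this]
  · have := h2 n k hk.le
    simp only [Function.comp_apply] at this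
    simp [this, hlt _ _ (hφ hk)]

theorem one_le_Ka (hinf : ¬FiniteDimensional ℝ Y) : 1 ≤ Ka Y := by
  have key : ∀ ε : ℝ, 0 < ε → (1 + ε)⁻¹ ≤ Ka Y := by
    intro ε hε
    obtain ⟨l, y, f, hl1, hy, hf, hd, hlow, hup⟩ := exists_step_system hinf hε
    have h0 : 0 < 1 + ε := by linarith
    have hinj : Function.Injective y := Function.Injective.of_lt_imp_ne fun i j hij e => by
      have h1 := hup i j hij
      rw [← e, hd i] at h1
      exact one_ne_zero h1
    have hval : ∀ n k, f n (y k) = if k < n then l else if k = n then 1 else 0 := fun n k => by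
      rcases lt_trichotomy k n with h | rfl | h
      · simp [h, hlow n k h]
      · simp [hd]
      · simp [h.not_gt, h.ne', hup n k h]
    refine le_Ka_of_seq hinj (fun n => (hy n).le) fun i j hij => ?_
    suffices ∃ g : Y →L[ℝ] ℝ, ‖g‖ ≤ 1 + ε ∧ 1 ≤ g (y j) - g (y i) ∧
        ∀ k, g (y i) ≤ g (y k) ∧ g (y k) ≤ g (y j) by
      obtain ⟨g, hg, hg1, hgk⟩ := this
      refine ⟨(1 + ε)⁻¹ • g, ?_, ?_, fun k => ⟨?_, ?_⟩⟩
      · rw [norm_smul, norm_inv, Real.norm_of_nonneg h0.le, inv_mul_le_iff₀ h0, mul_one]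
        exact hg
      · simp only [smul_apply, smul_eq_mul, ← mul_sub]
        exact le_mul_of_one_le_right (by positivity) hg1
      · simp only [smul_apply, smul_eq_mul]
        gcongr
        exact (hgk k).1
      · simp only [smul_apply, smul_eq_mul]
        gcongr
        exact (hgk k).2
    rcases le_total 0 l with hl | hl
    · refine ⟨-f i, by simpa using hf i, ?_, fun k => ?_⟩
      · simp [hval, hij.not_gt, hij.ne']
      · simp only [neg_apply, hval, hij.not_gt, hij.ne', lt_irrefl, if_true,
          if_false]
        split_ifs <;> constructor <;> linarith
    · refine ⟨f j, hf j, ?_, fun k => ?_⟩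
      · simp [hval, hij]
        exact hl
      · simp only [hval, hij, lt_irrefl, if_true, if_false]
        split_ifs <;> constructor <;> linarith
  have hlim : Tendsto (fun ε : ℝ => (1 + ε)⁻¹) (𝓝[>] 0) (𝓝 1) := by
    have : ContinuousAt (fun ε : ℝ => (1 + ε)⁻¹) 0 :=
      ContinuousAt.inv₀ (by fun_prop) (by norm_num)
    simpa using this.tendsto.mono_left nhdsWithin_le_nhds
  exact le_of_tendsto hlim (eventually_mem_nhdsWithin.mono key)

theorem exists_bounded_biorthogonal (hinf : ¬FiniteDimensional ℝ Y) :
    ∃ (C : ℝ) (y : ℕ → Y) (f : ℕ → Y →L[ℝ] ℝ), (∀ n, ‖y n‖ = 1) ∧ (∀ n, ‖f n‖ ≤ C) ∧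
      ∀ n k, f n (y k) = if n = k then 1 else 0 := by
  obtain ⟨l, y, f, -, hy, hf, hd, hlow, hup⟩ := exists_step_system hinf one_pos
  refine ⟨4, fun n => y (2 * n + 1), fun n => f (2 * n + 1) - f (2 * n), fun n => hy _,
    fun n => ?_, fun n k => ?_⟩
  · have := norm_sub_le (f (2 * n + 1)) (f (2 * n))
    linarith [hf (2 * n + 1), hf (2 * n)]
  · rcases lt_trichotomy n k with h | rfl | h
    · simp [h.ne, hup (2 * n + 1) (2 * k + 1) (by omega), hup (2 * n) (2 * k + 1) (by omega)]
    · simp [hd, hup (2 * n) (2 * n + 1) (by omega)]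
    · simp [h.ne', hlow (2 * n + 1) (2 * k + 1) (by omega), hlow (2 * n) (2 * k + 1) (by omega)]

/-- The space `Y` with the norm `max ‖y‖ (q y)`. -/
def Renorm (_q : Seminorm ℝ Y) : Type _ := Y

namespace Renorm

variable (q : Seminorm ℝ Y)

instance : AddCommGroup (Renorm q) := inferInstanceAs (AddCommGroup Y)

instance : Module ℝ (Renorm q) := inferInstanceAs (Module ℝ Y)

/-- The identity as a linear equivalence. -/
def equiv : Y ≃ₗ[ℝ] Renorm q := LinearEquiv.refl ℝ Y

instance : Norm (Renorm q) := ⟨fun x => max ‖(equiv q).symm x‖ (q ((equiv q).symm x))⟩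

theorem norm_def (x : Renorm q) :
    ‖x‖ = max ‖(equiv q).symm x‖ (q ((equiv q).symm x)) := rfl

theorem core : NormedSpace.Core ℝ (Renorm q) where
  norm_nonneg x := (norm_nonneg _).trans (le_max_left _ _)
  norm_smul c x := by
    simp only [norm_def, map_smul, norm_smul, map_smul_eq_mul]
    rw [mul_max_of_nonneg _ _ (norm_nonneg c)]
  norm_triangle x y := by
    simp only [norm_def, map_add]
    refine max_le ((norm_add_le _ _).trans ?_) ((map_add_le_add q _ _).trans ?_)
    · exact add_le_add (le_max_left _ _) (le_max_left _ _)
    · exact add_le_add (le_max_right _ _) (le_max_right _ _)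
  norm_eq_zero_iff x := by
    constructor
    · intro h
      have h1 : ‖(equiv q).symm x‖ ≤ 0 := (le_max_left _ _).trans h.le
      simpa using h1
    · rintro rfl
      simp [norm_def]

instance : NormedAddCommGroup (Renorm q) := NormedAddCommGroup.ofCore (core q)

instance : NormedSpace ℝ (Renorm q) := NormedSpace.ofCore (core q)

variable {q}

/-- The identity as a continuous linear equivalence. -/
def equivL {C : ℝ} (hq : ∀ x, q x ≤ C * ‖x‖) : Y ≃L[ℝ] Renorm q :=
  (equiv q).toContinuousLinearEquivOfBounds (max 1 C) 1
    (fun x => by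
      rw [norm_def, LinearEquiv.symm_apply_apply, max_mul_of_nonneg _ _ (norm_nonneg x), one_mul]
      exact max_le_max le_rfl (hq x))
    (fun x => by
      rw [one_mul]
      exact le_max_left _ _)

theorem completeSpace [CompleteSpace Y] {C : ℝ} (hq : ∀ x, q x ≤ C * ‖x‖) :
    CompleteSpace (Renorm q) :=
  (completeSpace_congr (e := (equivL hq).toEquiv) (equivL hq).isUniformEmbedding).1 inferInstance

end Renorm

theorem exists_seminorm_Ka_eq_two (hinf : ¬FiniteDimensional ℝ Y) :
    ∃ (q : Seminorm ℝ Y) (C : ℝ≥0), (∀ x, q x ≤ C * ‖x‖) ∧ Ka (Renorm q) = 2 := by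
  obtain ⟨C, y, f, hy, hf, hfy⟩ := exists_bounded_biorthogonal hinf
  have hC : 0 ≤ C := (norm_nonneg _).trans (hf 0)
  let p : ℕ × ℕ → Seminorm ℝ Y := fun i =>
    (normSeminorm ℝ ℝ).comp ((f i.1 - f i.2 : Y →L[ℝ] ℝ) : Y →ₗ[ℝ] ℝ)
  have hp : ∀ i x, p i x = |f i.1 x - f i.2 x| := fun i x => by simp [p]
  have hpC : ∀ i x, p i x ≤ (2 * C) * ‖x‖ := fun i x => by
    rw [hp]
    have h1 := (f i.1 - f i.2).le_of_opNorm_le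
      ((norm_sub_le _ _).trans (add_le_add (hf i.1) (hf i.2))) x
    simpa [two_mul] using h1
  have hbdd : BddAbove (range p) := by
    rw [Seminorm.bddAbove_range_iff]
    exact fun x => ⟨_, by rintro _ ⟨i, rfl⟩; exact hpC i x⟩
  have hq : ∀ x, (⨆ i, p i) x = ⨆ i, p i x := fun x => Seminorm.iSup_apply hbdd
  have hqC : ∀ x, (⨆ i, p i) x ≤ (2 * C) * ‖x‖ := fun x => by
    rw [hq]
    exact ciSup_le fun i => hpC i x
  have hle : ∀ i x, p i x ≤ (⨆ i, p i) x := fun i x => le_ciSup hbdd i x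
  refine ⟨⨆ i, p i, ⟨2 * C, by positivity⟩, hqC, le_antisymm Ka_le_two ?_⟩
  set q := ⨆ i, p i with hqdef
  have hinj : Function.Injective y := fun i j e => by
    by_contra hij
    have h1 := hfy i j
    rw [← e, hfy i i] at h1
    simp [hij] at h1
  refine le_Ka_of_seq (y := fun n => Renorm.equiv q (y n))
    ((Renorm.equiv q).injective.comp hinj) (fun n => ?_) fun i j hij => ?_
  · rw [Renorm.norm_def, LinearEquiv.symm_apply_apply, hy]
    refine max_le le_rfl ?_
    rw [hq]
    refine ciSup_le fun i => ?_
    rw [hp, hfy, hfy]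
    split_ifs <;> norm_num
  · have hbound : ∀ x : Renorm q, ‖(((f j - f i : Y →L[ℝ] ℝ) : Y →ₗ[ℝ] ℝ) ∘ₗ
        (Renorm.equiv q).symm.toLinearMap) x‖ ≤ 1 * ‖x‖ := fun x => by
      have h1 := hle (j, i) ((Renorm.equiv q).symm x)
      rw [hp] at h1
      rw [one_mul]
      exact h1.trans (le_max_right _ _)
    refine ⟨LinearMap.mkContinuous _ 1 hbound,
      LinearMap.mkContinuous_norm_le _ zero_le_one _, ?_, fun k => ?_⟩
    · simp [hfy, hij.ne, hij.ne']
      norm_num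
    · simp only [LinearMap.mkContinuous_apply, LinearMap.comp_apply, LinearEquiv.coe_coe,
        LinearEquiv.symm_apply_apply, ContinuousLinearMap.coe_coe, sub_apply,
        hfy, hij.ne, hij.ne', if_true, if_false]
      split_ifs with h1 h2
      · exact absurd (h2.trans h1.symm) hij.ne
      all_goals norm_num

theorem infinite_dimensional_of_equiv (hinf : ¬FiniteDimensional ℝ Y) (e : Y ≃ₗ[ℝ] Z) :
    ¬FiniteDimensional ℝ Z := fun _ => hinf e.symm.finiteDimensional

theorem one_le_Ka_renorm (hinf : ¬FiniteDimensional ℝ Y) (q : Seminorm ℝ Y) :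
    1 ≤ Ka (Renorm q) :=
  one_le_Ka (infinite_dimensional_of_equiv hinf (Renorm.equiv q))

theorem Ka_renorm_zero (hinf : ¬FiniteDimensional ℝ Y) :
    Ka (Renorm (0 : Seminorm ℝ Y)) = Ka Y := by
  have h : ∀ x : Renorm (0 : Seminorm ℝ Y), ‖x‖ = ‖(Renorm.equiv 0).symm x‖ := fun x => by
    simp [Renorm.norm_def]
  have h1 := Ka_le_mul_Ka (Renorm.equiv (0 : Seminorm ℝ Y)).symm one_pos one_pos
    (fun x => by simp [h]) (fun x => by simp [h]) (zero_le_one.trans (one_le_Ka hinf))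
  have h2 := Ka_le_mul_Ka (Renorm.equiv (0 : Seminorm ℝ Y)) one_pos one_pos
    (fun x => by simp [h]) (fun x => by simp [h])
    (zero_le_one.trans (one_le_Ka_renorm hinf _))
  linarith

theorem lipschitzWith_Ka_renorm (hinf : ¬FiniteDimensional ℝ Y) {q : Seminorm ℝ Y} {C : ℝ≥0}
    (hq : ∀ x, q x ≤ C * ‖x‖) :
    LipschitzWith (2 * C) fun t : ℝ≥0 => Ka (Renorm (t • q)) := by
  refine LipschitzWith.of_dist_le_mul fun s t => ?_
  wlog hst : s ≤ t generalizing s t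
  · rw [dist_comm, dist_comm s t]
    exact this t s (le_of_not_ge hst)
  have hst' : (s : ℝ) ≤ t := by exact_mod_cast hst
  let T : Renorm (s • q) ≃ₗ[ℝ] Renorm (t • q) := (Renorm.equiv _).symm.trans (Renorm.equiv _)
  have hs : ∀ x : Renorm (s • q), ‖x‖ =
      max ‖(Renorm.equiv _).symm x‖ (s * q ((Renorm.equiv _).symm x)) := fun x => rfl
  have ht : ∀ x : Renorm (t • q), ‖x‖ =
      max ‖(Renorm.equiv _).symm x‖ (t * q ((Renorm.equiv _).symm x)) := fun x => rfl
  set M : ℝ := 1 + C * (t - s) with hM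
  have hC : (0 : ℝ) ≤ C := C.2
  have hM1 : 1 ≤ M := by
    have := mul_nonneg hC (sub_nonneg.2 hst')
    linarith
  have hT : ∀ x, ‖T x‖ ≤ M * ‖x‖ := fun x => by
    rw [ht, hs]
    simp only [T, LinearEquiv.trans_apply, LinearEquiv.symm_apply_apply]
    set v := (Renorm.equiv (s • q)).symm x
    have h1 := le_max_left ‖v‖ (s * q v)
    have h2 := le_max_right ‖v‖ (s * q v)
    set m := max ‖v‖ (s * q v)
    have h3 := norm_nonneg v
    refine max_le (by nlinarith) ?_
    have h4 := mul_le_mul_of_nonneg_left (hq v) (sub_nonneg.2 hst')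
    have h5 := mul_le_mul_of_nonneg_left h1 (mul_nonneg hC (sub_nonneg.2 hst'))
    rw [hM]
    linarith
  have hTs : ∀ x, ‖T.symm x‖ ≤ 1 * ‖x‖ := fun x => by
    rw [ht, hs, one_mul]
    exact max_le_max le_rfl (mul_le_mul_of_nonneg_right hst' (apply_nonneg q _))
  have hM0 : 0 < M := by linarith
  have n1 := one_le_Ka_renorm hinf (s • q)
  have n2 := one_le_Ka_renorm hinf (t • q)
  have k1 := Ka_le_mul_Ka T hM0 one_pos hT hTs (by linarith)
  have k2 := Ka_le_mul_Ka T.symm one_pos hM0 hTs hT (by linarith)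
  have u1 : Ka (Renorm (s • q)) ≤ 2 := Ka_le_two
  have u2 : Ka (Renorm (t • q)) ≤ 2 := Ka_le_two
  rw [Real.dist_eq, NNReal.dist_eq, abs_sub_comm (s : ℝ), abs_of_nonneg (sub_nonneg.2 hst'),
    abs_le]
  push_cast
  constructor <;> nlinarith

/-- Every value between `Ka Y` and `2` is attained by a renorming of `Y`. -/
theorem exists_renorm_Ka_eq (hinf : ¬FiniteDimensional ℝ Y) {r : ℝ} (hr : r ∈ Icc (Ka Y) 2) :
    ∃ (q : Seminorm ℝ Y) (C : ℝ), (∀ x, q x ≤ C * ‖x‖) ∧ Ka (Renorm q) = r := by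
  obtain ⟨q, C, hqC, hq⟩ := exists_seminorm_Ka_eq_two hinf
  have hivt := intermediate_value_Icc (zero_le_one' ℝ≥0)
    (lipschitzWith_Ka_renorm hinf hqC).continuous.continuousOn
  have h0 : Ka (Renorm ((0 : ℝ≥0) • q)) = Ka Y := by
    rw [show (0 : ℝ≥0) • q = 0 by ext; simp, Ka_renorm_zero hinf]
  have h1 : Ka (Renorm ((1 : ℝ≥0) • q)) = 2 := by
    rw [one_smul, hq]
  rw [h0, h1] at hivt
  obtain ⟨t, -, ht⟩ := hivt hr
  refine ⟨t • q, t * C, fun x => ?_, ht⟩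
  rw [mul_assoc]
  exact mul_le_mul_of_nonneg_left (hqC x) t.2

theorem abs_Ka_sub_le (hY : ¬FiniteDimensional ℝ Y) (T : Y ≃L[ℝ] Z) :
    |Ka Y - Ka Z| ≤ 2 * (‖(T : Y →L[ℝ] Z)‖ * ‖(T.symm : Z →L[ℝ] Y)‖ - 1) := by
  have hZ : ¬FiniteDimensional ℝ Z := infinite_dimensional_of_equiv hY T.toLinearEquiv
  have hnY : Nontrivial Y := by
    by_contra h
    rw [not_nontrivial_iff_subsingleton] at h
    exact hY inferInstance
  have hnZ : Nontrivial Z := T.toEquiv.symm.nontrivial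
  have hA : 0 < ‖(T : Y →L[ℝ] Z)‖ := T.norm_pos
  have hB : 0 < ‖(T.symm : Z →L[ℝ] Y)‖ := T.symm.norm_pos
  have hM : 1 ≤ ‖(T : Y →L[ℝ] Z)‖ * ‖(T.symm : Z →L[ℝ] Y)‖ := T.one_le_norm_mul_norm_symm
  have n1 := one_le_Ka hY
  have n2 := one_le_Ka hZ
  have k1 := Ka_le_mul_Ka T.toLinearEquiv hA hB (T : Y →L[ℝ] Z).le_opNorm
    (T.symm : Z →L[ℝ] Y).le_opNorm (by linarith)
  have k2 := Ka_le_mul_Ka T.symm.toLinearEquiv hB hA (T.symm : Z →L[ℝ] Y).le_opNorm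
    (T : Y →L[ℝ] Z).le_opNorm (by linarith)
  have u1 : Ka Y ≤ 2 := Ka_le_two
  have u2 : Ka Z ≤ 2 := Ka_le_two
  rw [abs_le]
  constructor <;> nlinarith

end KottmanConstant

/-- K_a is continuous on the class of Banach spaces isomorphic to X with the
Banach-Mazur pseudometric D(Y,Z) = inf log(norm T * norm T.symm); consequently
the set of values of K_a on this class is an interval (b, 2] or [b, 2] for
some b in [1, 2]. -/
theorem stmt19 (X : Type u) [NormedAddCommGroup X] [NormedSpace ℝ X]
    [CompleteSpace X] (hinf : ¬FiniteDimensional ℝ X) :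
    (∀ ε : ℝ, 0 < ε → ∃ δ : ℝ, 0 < δ ∧
      ∀ (Y : Type u) [NormedAddCommGroup Y] [NormedSpace ℝ Y] [CompleteSpace Y]
        (Z : Type u) [NormedAddCommGroup Z] [NormedSpace ℝ Z] [CompleteSpace Z],
        Nonempty (X ≃L[ℝ] Y) → Nonempty (X ≃L[ℝ] Z) →
        (∃ T : Y ≃L[ℝ] Z,
          Real.log (‖(T : Y →L[ℝ] Z)‖ * ‖(T.symm : Z →L[ℝ] Y)‖) < δ) →
        |Ka Y - Ka Z| < ε) ∧
    (∃ b : ℝ, b ∈ Set.Icc (1:ℝ) 2 ∧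
      ({r : ℝ | ∃ (Y : Type u) (_ : NormedAddCommGroup Y) (_ : NormedSpace ℝ Y)
          (_ : CompleteSpace Y), Nonempty (X ≃L[ℝ] Y) ∧ Ka Y = r}
        = Set.Ioc b 2 ∨
       {r : ℝ | ∃ (Y : Type u) (_ : NormedAddCommGroup Y) (_ : NormedSpace ℝ Y)
          (_ : CompleteSpace Y), Nonempty (X ≃L[ℝ] Y) ∧ Ka Y = r}
        = Set.Icc b 2)) := by
  refine ⟨fun ε hε => ⟨Real.log (1 + ε / 2), Real.log_pos (by linarith), ?_⟩, ?_⟩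
  · rintro Y _ _ _ Z _ _ _ ⟨e⟩ - ⟨T, hT⟩
    have hY : ¬FiniteDimensional ℝ Y := infinite_dimensional_of_equiv hinf e.toLinearEquiv
    refine (abs_Ka_sub_le hY T).trans_lt ?_
    set M := ‖(T : Y →L[ℝ] Z)‖ * ‖(T.symm : Z →L[ℝ] Y)‖
    rcases le_or_gt M 0 with hM | hM
    · linarith
    · linarith [(Real.log_lt_log_iff hM (by linarith)).1 hT]
  · set V := {r : ℝ | ∃ (Y : Type u) (_ : NormedAddCommGroup Y) (_ : NormedSpace ℝ Y)
          (_ : CompleteSpace Y), Nonempty (X ≃L[ℝ] Y) ∧ Ka Y = r} with hV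
    have hup : ∀ r ∈ V, Icc r 2 ⊆ V := by
      rintro _ ⟨Y, _, _, _, ⟨e⟩, rfl⟩ s hs
      have hY : ¬FiniteDimensional ℝ Y := infinite_dimensional_of_equiv hinf e.toLinearEquiv
      obtain ⟨q, C, hqC, hq⟩ := exists_renorm_Ka_eq hY hs
      exact ⟨Renorm q, inferInstance, inferInstance, Renorm.completeSpace hqC,
        ⟨e.trans (Renorm.equivL hqC)⟩, hq⟩
    have hbd : V ⊆ Icc 1 2 := by
      rintro _ ⟨Y, _, _, _, ⟨e⟩, rfl⟩
      exact ⟨one_le_Ka (infinite_dimensional_of_equiv hinf e.toLinearEquiv), Ka_le_two⟩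
    have hX : Ka X ∈ V :=
      ⟨X, inferInstance, inferInstance, inferInstance, ⟨ContinuousLinearEquiv.refl ℝ X⟩, rfl⟩
    have hbelow : BddBelow V := ⟨1, fun r hr => (hbd hr).1⟩
    have hgt : Ioc (sInf V) 2 ⊆ V := fun r hr => by
      obtain ⟨s, hs, hsr⟩ := exists_lt_of_csInf_lt ⟨_, hX⟩ hr.1
      exact hup s hs ⟨hsr.le, hr.2⟩
    refine ⟨sInf V, ⟨le_csInf ⟨_, hX⟩ fun r hr => (hbd hr).1,
      (csInf_le hbelow hX).trans (hbd hX).2⟩, ?_⟩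
    by_cases hmem : sInf V ∈ V
    · exact Or.inr (Subset.antisymm (fun r hr => ⟨csInf_le hbelow hr, (hbd hr).2⟩)
        (hup _ hmem))
    · refine Or.inl (Subset.antisymm (fun r hr => ⟨?_, (hbd hr).2⟩) hgt)
      exact lt_of_le_of_ne (csInf_le hbelow hr) fun e => hmem (e ▸ hr)
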